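/- Let k ≥ 1 and let J be any nonempty instruction sequence. Consider execution of NEXT; J starting at position 1 in a state where aux:i holds a_i ∈ {t, f} for 1 ≤ i ≤ k. If a_i = f for all i, then execution terminates with reply f, and in the state at termination aux:i holds t for all 1 ≤ i ≤ k and all other registers are unchanged. Otherwise, letting i₀ be the least index with a_{i₀} = t, execution reaches position 5k + 2 (the first instruction of J) in the state where aux:j holds t for j < i₀, aux:i₀ holds f, aux:j holds a_j for i₀ < j ≤ k, and all other registers are unchanged. -/

import Mathlib

/-- A focus (register name): an input register `in:i` or an auxiliary register `aux:i`. -/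
inductive Focus
  | inp (i : ℕ)
  | aux (i : ℕ)
  deriving DecidableEq

/-- A method of a Boolean register service. -/
inductive Method
  | setT
  | setF
  | get
  deriving DecidableEq

/-- A PGLB_bt primitive instruction. -/
inductive Instr
  | basic (f : Focus) (m : Method)   -- f.m
  | pos (f : Focus) (m : Method)     -- +f.m
  | neg (f : Focus) (m : Method)     -- -f.m
  | fjmp (l : ℕ)                     -- #l
  | bjmp (l : ℕ)                     -- \#l
  | termT                            -- !t
  | termF                            -- !f
  deriving DecidableEq

/-- A state assigns to every register a value in {t, f, d}; `none` represents `d`. -/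
abbrev St := Focus → Option Bool

/-- The reply produced when processing method `m` on a register holding `x`. -/
def procReply (m : Method) (x : Option Bool) : Option Bool :=
  match x, m with
  | none, _ => none
  | some b, .get => some b
  | some _, .setT => some true
  | some _, .setF => some true

/-- The new register value after processing method `m` on a register holding `x`. -/
def procEff (m : Method) (x : Option Bool) : Option Bool :=
  match x, m with
  | none, _ => none
  | some b, .get => some b
  | some _, .setT => some true
  | some _, .setF => some false

/-- Update a state by processing method `m` on the register named `f`. -/
def updSt (s : St) (f : Focus) (m : Method) : St :=
  fun g => if g = f then procEff m (s f) else s g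

/-- An execution configuration: running at a (1-based) position in a state,
terminated with a reply (recording the final state), or deadlocked. -/
inductive Config
  | running (i : ℕ) (s : St)
  | terminated (r : Bool) (s : St)
  | deadlock

/-- One execution step of the instruction sequence `I`. -/
def step (I : List Instr) : Config → Config
  | .terminated r s => .terminated r s
  | .deadlock => .deadlock
  | .running i s =>
    if i = 0 then .deadlock
    else
      match I[i - 1]? with
      | none => .deadlock
      | some u =>
        match u with
        | .basic f m =>
          match procReply m (s f) with
          | none => .deadlock
          | some _ => .running (i + 1) (updSt s f m)
        | .pos f m =>
          match procReply m (s f) with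
          | none => .deadlock
          | some true => .running (i + 1) (updSt s f m)
          | some false => .running (i + 2) (updSt s f m)
        | .neg f m =>
          match procReply m (s f) with
          | none => .deadlock
          | some true => .running (i + 2) (updSt s f m)
          | some false => .running (i + 1) (updSt s f m)
        | .fjmp l => .running (i + l) s
        | .bjmp l => if l < i then .running (i - l) s else .deadlock
        | .termT => .terminated true s
        | .termF => .terminated false s

/-- The configuration after `n` execution steps of `I`, starting at position 1 in state `s`. -/
def run (I : List Instr) (s : St) (n : ℕ) : Config :=
  (step I)^[n] (.running 1 s)

/-- Execution of `I` from state `s` terminates with reply `r`. -/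
def TermWith (I : List Instr) (s : St) (r : Bool) : Prop :=
  ∃ n s', run I s n = .terminated r s'

/-- An instruction sequence is loop-free if it contains no backward jump. -/
def LoopFree (I : List Instr) : Prop := ∀ l, Instr.bjmp l ∉ I

/-- An instruction refers to an auxiliary register. -/
def UsesAux : Instr → Prop
  | .basic (.aux _) _ => True
  | .pos (.aux _) _ => True
  | .neg (.aux _) _ => True
  | _ => False

/-- The initial state for computing a `k`-ary function using `l` auxiliary registers:
`in:i` holds `b_i` for `1 ≤ i ≤ k`, `aux:j` holds `t` for `1 ≤ j ≤ l`,
all other registers hold `d`. -/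
def initSt (k l : ℕ) (b : Fin k → Bool) : St
  | .inp i => if h : 1 ≤ i ∧ i ≤ k then some (b ⟨i - 1, by omega⟩) else none
  | .aux j => if 1 ≤ j ∧ j ≤ l then some true else none

/-- `I` computes the partial function `F : Bool^k ⇀ Bool` using `l` auxiliary registers. -/
def Computes (I : List Instr) (k l : ℕ) (F : (Fin k → Bool) → Option Bool) : Prop :=
  ∀ b : Fin k → Bool,
    (∀ r : Bool, F b = some r → TermWith I (initSt k l b) r) ∧
    (F b = none → ∀ r : Bool, ¬ TermWith I (initSt k l b) r)

/-- `NEXT_i = -aux:i.get; #3; aux:i.set:f; #5; aux:i.set:t` (for `1 ≤ i < k`). -/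
def NEXTi (i : ℕ) : List Instr :=
  [.neg (.aux i) .get, .fjmp 3, .basic (.aux i) .setF, .fjmp 5, .basic (.aux i) .setT]

/-- `NEXT_k = -aux:k.get; #3; aux:k.set:f; #3; aux:k.set:t; !f`. -/
def NEXTlast (k : ℕ) : List Instr :=
  [.neg (.aux k) .get, .fjmp 3, .basic (.aux k) .setF, .fjmp 3, .basic (.aux k) .setT,
   .termF]

/-- `NEXT = NEXT_1; … ; NEXT_{k-1}; NEXT_k`, the assignment generator of length `5k + 1`. -/
def NEXT (k : ℕ) : List Instr :=
  (List.range (k - 1)).flatMap (fun i => NEXTi (i + 1)) ++ NEXTlast k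

/-- Configuration `c'` is reached from `c` after finitely many steps of `I`. -/
def Reaches (I : List Instr) (c c' : Config) : Prop := ∃ n : ℕ, (step I)^[n] c = c'

theorem Reaches.refl (I : List Instr) (c : Config) : Reaches I c c := ⟨0, rfl⟩

theorem Reaches.trans {I : List Instr} {c c' c'' : Config}
    (h : Reaches I c c') (h' : Reaches I c' c'') : Reaches I c c'' := by
  obtain ⟨m, rfl⟩ := h
  obtain ⟨n, rfl⟩ := h'
  exact ⟨n + m, Function.iterate_add_apply _ _ _ _⟩

theorem Reaches.head {I : List Instr} {c c' : Config} (h : Reaches I (step I c) c') :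
    Reaches I c c' :=
  Reaches.trans ⟨1, rfl⟩ h

theorem length_flatMap_range {α : Type*} (f : ℕ → List α) (c : ℕ)
    (hf : ∀ i, (f i).length = c) (m : ℕ) : ((List.range m).flatMap f).length = c * m := by
  simp [List.length_flatMap, hf, mul_comm]

theorem getElem?_flatMap_range_append {α : Type*} (f : ℕ → List α) (c : ℕ)
    (hf : ∀ i, (f i).length = c) (m : ℕ) (L : List α) {i r : ℕ} (hi : i < m) (hr : r < c) :
    ((List.range m).flatMap f ++ L)[c * i + r]? = (f i)[r]? := by
  induction m generalizing L with
  | zero => omega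
  | succ m ih =>
    rw [List.range_succ, List.flatMap_append, List.append_assoc]
    rcases Nat.lt_succ_iff_lt_or_eq.mp hi with h | rfl
    · exact ih _ h
    · rw [List.getElem?_append_right (by rw [length_flatMap_range f c hf]; omega),
        length_flatMap_range f c hf, Nat.add_sub_cancel_left]
      simp [List.getElem?_append_left, hf, hr]

theorem NEXT_append_getElem?_block (k : ℕ) (J : List Instr) {i r : ℕ} (hi : i + 1 < k)
    (hr : r < 5) : (NEXT k ++ J)[5 * i + r]? = (NEXTi (i + 1))[r]? := by
  rw [NEXT, List.append_assoc]
  exact getElem?_flatMap_range_append (fun i => NEXTi (i + 1)) 5 (fun _ => rfl) _ _ (by omega) hr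

theorem NEXT_append_getElem?_last (i : ℕ) (J : List Instr) {r : ℕ} (hr : r < 6) :
    (NEXT (i + 1) ++ J)[5 * i + r]? = (NEXTlast (i + 1))[r]? := by
  have hlen := length_flatMap_range (fun i => NEXTi (i + 1)) 5 (fun _ => rfl) i
  rw [NEXT, List.append_assoc, Nat.add_sub_cancel, List.getElem?_append_right (by omega), hlen,
    Nat.add_sub_cancel_left, List.getElem?_append_left (by simpa [NEXTlast] using hr)]

/-- The blocks of `NEXT` agree with `NEXTi`, except for the length of the exit jump. -/
theorem NEXT_append_getElem? (k : ℕ) (J : List Instr) {i r : ℕ} (hi : i < k) (hr : r < 5)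
    (hr3 : r ≠ 3) : (NEXT k ++ J)[5 * i + r]? = (NEXTi (i + 1))[r]? := by
  rcases Nat.lt_or_ge (i + 1) k with h | h
  · exact NEXT_append_getElem?_block k J h hr
  · obtain rfl : k = i + 1 := by omega
    rw [NEXT_append_getElem?_last i J (by omega)]
    interval_cases r <;> simp_all [NEXTi, NEXTlast]

/-- The exit jumps of `NEXT` are chained and lead past its end. -/
theorem reaches_exit (k : ℕ) (J : List Instr) (s : St) {i : ℕ} (hi : i < k) :
    Reaches (NEXT k ++ J) (.running (5 * i + 4) s) (.running (5 * k + 2) s) := by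
  obtain ⟨d, rfl⟩ := Nat.exists_eq_add_of_lt hi
  induction d generalizing i with
  | zero =>
    apply Reaches.head
    simpa [step, NEXT_append_getElem?_last i J (r := 3) (by omega), NEXTlast, mul_add, add_assoc]
      using Reaches.refl _ _
  | succ d ih =>
    apply Reaches.head
    have h := ih (i := i + 1) (by omega)
    rw [show i + 1 + d + 1 = i + (d + 1) + 1 by omega,
      show 5 * (i + 1) + 4 = 5 * i + 4 + 5 by ring] at h
    simpa [step, NEXT_append_getElem?_block _ J (show i + 1 < i + (d + 1) + 1 by omega)
      (show 3 < 5 by omega), NEXTi] using h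

/-- A block of `NEXT` whose register holds `f` sets it to `t` and passes to the next block. -/
theorem reaches_of_false (k : ℕ) (J : List Instr) (s : St) {i : ℕ} (hi : i < k)
    (h : s (.aux (i + 1)) = some false) :
    Reaches (NEXT k ++ J) (.running (5 * i + 1) s)
      (.running (5 * (i + 1) + 1) (Function.update s (.aux (i + 1)) (some true))) := by
  refine ⟨3, ?_⟩
  have h0 := NEXT_append_getElem? k J hi (r := 0) (by omega) (by omega)
  have h1 := NEXT_append_getElem? k J hi (r := 1) (by omega) (by omega)
  have h4 := NEXT_append_getElem? k J hi (r := 4) (by omega) (by omega)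
  rw [Nat.add_zero] at h0
  simp only [Function.iterate_succ_apply, Function.iterate_zero_apply]
  simp [step, h0, h1, h4, NEXTi, h, procReply, updSt, procEff]
  refine ⟨by ring, ?_⟩
  ext1 g
  by_cases hg : g = .aux (i + 1) <;> simp [hg, h, updSt, procEff]

/-- A block of `NEXT` whose register holds `t` sets it to `f` and leaves `NEXT`. -/
theorem reaches_of_true (k : ℕ) (J : List Instr) (s : St) {i : ℕ} (hi : i < k)
    (h : s (.aux (i + 1)) = some true) :
    Reaches (NEXT k ++ J) (.running (5 * i + 1) s)
      (.running (5 * k + 2) (Function.update s (.aux (i + 1)) (some false))) := by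
  refine Reaches.trans ⟨2, ?_⟩ (reaches_exit k J _ hi)
  have h0 := NEXT_append_getElem? k J hi (r := 0) (by omega) (by omega)
  have h2 := NEXT_append_getElem? k J hi (r := 2) (by omega) (by omega)
  rw [Nat.add_zero] at h0
  simp only [Function.iterate_succ_apply, Function.iterate_zero_apply]
  simp [step, h0, h2, NEXTi, h, procReply, updSt, procEff]
  ext1 g
  by_cases hg : g = .aux (i + 1) <;> simp [hg, h, updSt, procEff]

/-- The state `s` with `aux:1, …, aux:m` set to `t`. -/
def setAuxTrue (s : St) : ℕ → St
  | 0 => s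
  | m + 1 => Function.update (setAuxTrue s m) (.aux (m + 1)) (some true)

theorem setAuxTrue_inp (s : St) (m i : ℕ) : setAuxTrue s m (.inp i) = s (.inp i) := by
  induction m with
  | zero => rfl
  | succ m ih => simp [setAuxTrue, ih]

theorem setAuxTrue_aux (s : St) (m i : ℕ) :
    setAuxTrue s m (.aux i) = if 1 ≤ i ∧ i ≤ m then some true else s (.aux i) := by
  induction m with
  | zero => exact (if_neg (by omega)).symm
  | succ m ih =>
    simp only [setAuxTrue, Function.update_apply, Focus.aux.injEq, ih]
    grind

/-- Leading blocks of `NEXT` whose registers hold `f` are passed, setting them to `t`. -/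
theorem reaches_setAuxTrue (k : ℕ) (J : List Instr) (s : St) {m : ℕ} (hm : m ≤ k)
    (h : ∀ i, 1 ≤ i → i ≤ m → s (.aux i) = some false) :
    Reaches (NEXT k ++ J) (.running 1 s) (.running (5 * m + 1) (setAuxTrue s m)) := by
  induction m with
  | zero => exact Reaches.refl _ _
  | succ m ih =>
    refine (ih (by omega) fun i h1 h2 => h i h1 (by omega)).trans ?_
    refine reaches_of_false k J _ hm ?_
    simpa [setAuxTrue_aux] using h (m + 1) (by omega) le_rfl

/-- Behaviour of the assignment generator `NEXT` (followed by any nonempty `J`):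
if all of `aux:1, …, aux:k` hold `f`, execution terminates with reply `f` in the state
where all of them hold `t` and all other registers are unchanged; otherwise, with `i₀`
the least index holding `t`, execution reaches position `5k + 2` (the first instruction
of `J`) in the state where `aux:j` holds `t` for `j < i₀`, `aux:i₀` holds `f`, and all
other registers are unchanged. -/
theorem statement6 (k : ℕ) (hk : 1 ≤ k) (J : List Instr) (hJ : J ≠ [])
    (s : St) (a : ℕ → Bool)
    (hs : ∀ i : ℕ, 1 ≤ i → i ≤ k → s (.aux i) = some (a i)) :
    ((∀ i : ℕ, 1 ≤ i → i ≤ k → a i = false) →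
      ∃ n : ℕ, run (NEXT k ++ J) s n =
        .terminated false (fun f => match f with
          | .aux i => if 1 ≤ i ∧ i ≤ k then some true else s (.aux i)
          | .inp i => s (.inp i))) ∧
    (∀ i₀ : ℕ, 1 ≤ i₀ → i₀ ≤ k → a i₀ = true →
      (∀ j : ℕ, 1 ≤ j → j < i₀ → a j = false) →
      ∃ n : ℕ, run (NEXT k ++ J) s n =
        .running (5 * k + 2) (fun f => match f with
          | .aux j => if 1 ≤ j ∧ j < i₀ then some true
                      else if j = i₀ then some false else s (.aux j)
          | .inp i => s (.inp i))) := by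
  refine ⟨fun ha => ?_, fun i₀ h1 hle htrue hfalse => ?_⟩
  · refine (reaches_setAuxTrue k J s le_rfl fun i h1 h2 => by
      rw [hs i h1 h2, ha i h1 h2]).trans ⟨1, ?_⟩
    obtain ⟨i, rfl⟩ := Nat.exists_eq_add_of_le' hk
    have h5 : (NEXT (i + 1) ++ J)[5 * (i + 1)]? = some .termF :=
      NEXT_append_getElem?_last i J (r := 5) (by omega)
    simp only [Function.iterate_one, step, Nat.add_sub_cancel, h5]
    rw [if_neg (Nat.succ_ne_zero _)]
    congr 1
    ext1 (j | j)
    · exact setAuxTrue_inp ..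
    · exact setAuxTrue_aux ..
  · obtain ⟨i, rfl⟩ := Nat.exists_eq_add_of_le' h1
    have hscan := reaches_setAuxTrue k J s (m := i) (by omega) fun j h1 h2 => by
      rw [hs j h1 (by omega), hfalse j h1 (by omega)]
    have hexit := reaches_of_true k J (setAuxTrue s i) hle (by
      simpa [setAuxTrue_aux, htrue] using hs (i + 1) h1 hle)
    obtain ⟨n, hn⟩ := hscan.trans hexit
    refine ⟨n, hn.trans ?_⟩
    congr 1
    ext1 (j | j)
    · simp [setAuxTrue_inp]
    · simp only [setAuxTrue_aux, Function.update_apply, Focus.aux.injEq]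
      grind
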